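/- arXiv:0712.4359 — 2 statements merged into one kernel-verified Lean document; each statement's English description precedes it below -/
import Mathlib

section
/- Let F = (f_1,…,f_m) be an exponential-sum mapping on ℂ^n, and suppose there exist ω_1,…,ω_s ∈ ℝ^n, linearly independent over ℝ, which generate the additive subgroup Ξ_F of ℝ^n generated by S_1 ∪ … ∪ S_m (i.e. Ξ_F = ℤω_1 + ⋯ + ℤω_s). Then 𝒴_F = Im V(F), and Im V(F) is a closed subset of ℝ^n (hence equals the amoeba of F). -/
open Complex

/-- The exponential sum with spectrum `S` and coefficients `a`:
`z ↦ ∑_{λ ∈ S} a(λ) e^{i⟨z,λ⟩}`. -/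
noncomputable def expComp {n : ℕ} (S : Finset (Fin n → ℝ)) (a : (Fin n → ℝ) → ℂ)
    (z : Fin n → ℂ) : ℂ :=
  ∑ l ∈ S, a l * Complex.exp (Complex.I * ∑ k, z k * (l k : ℂ))

/-- `Im V(F)`: the image under the componentwise imaginary part of the common
zero set of the components of the exponential-sum mapping. -/
def imZeroSet {n m : ℕ} (S : Fin m → Finset (Fin n → ℝ))
    (a : Fin m → (Fin n → ℝ) → ℂ) : Set (Fin n → ℝ) :=
  (fun z : Fin n → ℂ => fun k => (z k).im) ''
    {z | ∀ ℓ : Fin m, expComp (S ℓ) (a ℓ) z = 0}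

/-- The 𝒴-amoeba of the exponential-sum mapping with spectra `S` and
coefficients `a`: the union over all characters `χ` of `ℝⁿ` of `Im V(F_χ)`. -/
def yamoeba {n m : ℕ} (S : Fin m → Finset (Fin n → ℝ))
    (a : Fin m → (Fin n → ℝ) → ℂ) : Set (Fin n → ℝ) :=
  {η | ∃ χ : (Fin n → ℝ) → ℂ, (∀ v, ‖χ v‖ = 1) ∧ (∀ v w, χ (v + w) = χ v * χ w) ∧
    η ∈ imZeroSet S (fun ℓ l => a ℓ l * χ l)}

/-- Twisting the coefficients by `l ↦ e^{i⟨x,l⟩}` amounts to translating the argument by `x`. -/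
theorem expComp_mul_eq_expComp_add {n : ℕ} (S : Finset (Fin n → ℝ)) (a χ : (Fin n → ℝ) → ℂ)
    (x : Fin n → ℝ) (h : ∀ l ∈ S, χ l = exp (I * ∑ k, (x k : ℂ) * (l k : ℂ))) (z : Fin n → ℂ) :
    expComp S (fun l => a l * χ l) z = expComp S a (fun k => x k + z k) := by
  refine Finset.sum_congr rfl fun l hl => ?_
  simp only [add_mul, Finset.sum_add_distrib, mul_add, Complex.exp_add, h l hl]
  ring

theorem continuous_expComp {n : ℕ} (S : Finset (Fin n → ℝ)) (a : (Fin n → ℝ) → ℂ) :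
    Continuous (expComp S a) := by
  unfold expComp
  fun_prop

/-- Pairing with linearly independent vectors has a linear right inverse. -/
theorem LinearIndependent.exists_linearMap_sum_mul_eq {n s : ℕ} {ω : Fin s → Fin n → ℝ}
    (hω : LinearIndependent ℝ ω) :
    ∃ R : (Fin s → ℝ) →ₗ[ℝ] (Fin n → ℝ), ∀ θ j, ∑ k, R θ k * ω j k = θ j := by
  have hsurj : Function.Surjective (Matrix.mulVecLin (Matrix.of ω)) := by
    intro θ
    obtain ⟨f, hf⟩ := LinearMap.exists_extend
      ((Module.Basis.span hω).constr ℝ θ : Submodule.span ℝ (Set.range ω) →ₗ[ℝ] ℝ)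
    refine ⟨fun k => f fun j => if k = j then 1 else 0, funext fun j => ?_⟩
    have hj := LinearMap.congr_fun hf (Module.Basis.span hω j)
    rw [Module.Basis.constr_basis, LinearMap.comp_apply, Submodule.subtype_apply,
      Module.Basis.span_apply, LinearMap.pi_apply_eq_sum_univ] at hj
    rw [← hj]
    simp [Matrix.mulVec, dotProduct]
  obtain ⟨R, hR⟩ := LinearMap.exists_rightInverse_of_surjective _ (LinearMap.range_eq_top.2 hsurj)
  refine ⟨R, fun θ j => ?_⟩
  have := congrFun (LinearMap.congr_fun hR θ) j
  simpa [Matrix.mulVec, dotProduct, mul_comm] using this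

/-- Two unimodular characters which agree on a set agree on the subgroup it generates. -/
theorem eq_of_mem_addSubgroup_closure {G : Type*} [AddCommGroup G] {χ ψ : G → ℂ}
    (hχ : ∀ v, ‖χ v‖ = 1) (hχ_add : ∀ v w, χ (v + w) = χ v * χ w)
    (hψ : ∀ v, ‖ψ v‖ = 1) (hψ_add : ∀ v w, ψ (v + w) = ψ v * ψ w)
    {T : Set G} (h : ∀ v ∈ T, χ v = ψ v) {v : G} (hv : v ∈ AddSubgroup.closure T) :
    χ v = ψ v := by
  have map_zero : ∀ {φ : G → ℂ}, (∀ v, ‖φ v‖ = 1) → (∀ v w, φ (v + w) = φ v * φ w) →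
      φ 0 = 1 := by
    intro φ hφ hφ_add
    have h0 : φ 0 ≠ 0 := norm_ne_zero_iff.1 (by simp [hφ])
    exact mul_left_cancel₀ h0 (by rw [← hφ_add]; simp)
  have zero_eq : χ 0 = ψ 0 := (map_zero hχ hχ_add).trans (map_zero hψ hψ_add).symm
  induction hv using AddSubgroup.closure_induction with
  | mem x hx => exact h x hx
  | zero => exact zero_eq
  | add x y _ _ hx hy => rw [hχ_add, hψ_add, hx, hy]
  | neg x _ hx =>
    have h0 : χ x ≠ 0 := norm_ne_zero_iff.1 (by simp [hχ])
    refine mul_left_cancel₀ h0 ?_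
    rw [← hχ_add]
    rw [hx, ← hψ_add, add_neg_cancel, zero_eq]

theorem norm_exp_I_mul_sum {n : ℕ} (x l : Fin n → ℝ) :
    ‖exp (I * ∑ k, (x k : ℂ) * (l k : ℂ))‖ = 1 := by
  have := norm_exp_I_mul_ofReal (∑ k, x k * l k)
  push_cast at this
  exact this

theorem exp_I_mul_sum_add {n : ℕ} (x v w : Fin n → ℝ) :
    exp (I * ∑ k, (x k : ℂ) * ((v + w) k : ℂ)) =
      exp (I * ∑ k, (x k : ℂ) * (v k : ℂ)) * exp (I * ∑ k, (x k : ℂ) * (w k : ℂ)) := by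
  simp [← Complex.exp_add, mul_add, Finset.sum_add_distrib]

/-- On the group generated by `ω`, every character has the form `l ↦ e^{i⟨R θ,l⟩}` with `θ`
in a fixed cube, if `R` is a right inverse of the pairing with `ω`. -/
theorem exists_eq_exp_of_mem_closure {n s : ℕ} {ω : Fin s → Fin n → ℝ}
    {R : (Fin s → ℝ) → Fin n → ℝ} (hR : ∀ θ j, ∑ k, R θ k * ω j k = θ j)
    {χ : (Fin n → ℝ) → ℂ} (hχ : ∀ v, ‖χ v‖ = 1) (hχ_add : ∀ v w, χ (v + w) = χ v * χ w) :
    ∃ θ ∈ Set.Icc (fun _ => -Real.pi) (fun _ : Fin s => Real.pi),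
      ∀ l ∈ AddSubgroup.closure (Set.range ω),
        χ l = exp (I * ∑ k, (R θ k : ℂ) * (l k : ℂ)) := by
  obtain ⟨θ, hθ⟩ : ∃ θ : Fin s → ℝ, ∀ j, θ j = arg (χ (ω j)) := ⟨_, fun _ => rfl⟩
  have hθ_mem : θ ∈ Set.Icc (fun _ => -Real.pi) (fun _ : Fin s => Real.pi) := by
    constructor <;> intro j
    · rw [hθ]
      exact (neg_pi_lt_arg _).le
    · rw [hθ]
      exact arg_le_pi _
  refine ⟨θ, hθ_mem, fun l hl => ?_⟩
  suffices h : ∀ v ∈ Set.range ω, χ v = exp (I * ∑ k, (R θ k : ℂ) * (v k : ℂ)) from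
    eq_of_mem_addSubgroup_closure (G := Fin n → ℝ) (T := Set.range ω)
      (ψ := fun v => exp (I * ∑ k, (R θ k : ℂ) * (v k : ℂ))) hχ hχ_add
      (fun v => norm_exp_I_mul_sum (R θ) v) (fun v w => exp_I_mul_sum_add (R θ) v w) h hl
  rintro _ ⟨j, rfl⟩
  have hj : ∑ k, (R θ k : ℂ) * (ω j k : ℂ) = (arg (χ (ω j)) : ℂ) := by
    rw [← hθ, ← hR θ j]
    push_cast
    rfl
  rw [hj, mul_comm]
  have h := norm_mul_exp_arg_mul_I (χ (ω j))
  rw [hχ, ofReal_one, one_mul] at h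
  exact h.symm

/-- Lemma 4.3: if the ℤ-module `Ξ_F` generated by the union of the spectra is
generated by ℝ-linearly independent vectors `ω_1, …, ω_s`, then
`𝒴_F = Im V(F)` and `Im V(F)` is closed (hence equals the amoeba of `F`). -/
theorem yamoeba_eq_imZeroSet_of_free_module (n m s : ℕ)
    (S : Fin m → Finset (Fin n → ℝ)) (hS : ∀ ℓ, (S ℓ).Nonempty)
    (a : Fin m → (Fin n → ℝ) → ℂ) (ha : ∀ ℓ, ∀ l ∈ S ℓ, a ℓ l ≠ 0)
    (ω : Fin s → Fin n → ℝ) (hω : LinearIndependent ℝ ω)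
    (hgen : AddSubgroup.closure (⋃ ℓ : Fin m, ((S ℓ : Set (Fin n → ℝ))))
      = AddSubgroup.closure (Set.range ω)) :
    yamoeba S a = imZeroSet S a ∧ IsClosed (imZeroSet S a) := by
  obtain ⟨R, hR⟩ := hω.exists_linearMap_sum_mul_eq
  have hmem : ∀ ℓ, ∀ l ∈ S ℓ, l ∈ AddSubgroup.closure (Set.range ω) := fun ℓ l hl =>
    hgen ▸ AddSubgroup.subset_closure (Set.mem_iUnion.2 ⟨ℓ, hl⟩)
  refine ⟨Set.Subset.antisymm ?_ ?_, ?_⟩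
  · rintro _ ⟨χ, hχ, hχ_add, z, hz, rfl⟩
    obtain ⟨θ, -, hθ⟩ := exists_eq_exp_of_mem_closure hR hχ hχ_add
    refine ⟨fun k => R θ k + z k, fun ℓ => ?_, by simp⟩
    rw [← expComp_mul_eq_expComp_add (S ℓ) (a ℓ) χ (R θ) fun l hl => hθ l (hmem ℓ l hl)]
    exact hz ℓ
  · intro η hη
    exact ⟨fun _ => 1, by simp, by simp, by simpa using hη⟩
  · set K : Set (Fin s → ℝ) := Set.Icc (fun _ => -Real.pi) (fun _ => Real.pi)
    have : CompactSpace K := isCompact_iff_compactSpace.1 isCompact_Icc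
    let Z : Set (K × (Fin n → ℝ)) :=
      {p | ∀ ℓ, expComp (S ℓ) (a ℓ) (fun k => (R p.1 k : ℂ) + p.2 k * I) = 0}
    have hRc : Continuous R := R.continuous_of_finiteDimensional
    have hZ : IsClosed Z := by
      simp only [Z, Set.ofPred_forall]
      refine isClosed_iInter fun ℓ => isClosed_eq ((continuous_expComp _ _).comp ?_)
        continuous_const
      fun_prop
    convert isClosedMap_snd_of_compactSpace Z hZ using 1
    ext η
    constructor
    · rintro ⟨z, hz, rfl⟩
      let x : Fin n → ℝ := fun k => (z k).re
      obtain ⟨θ, hθK, hθ⟩ := exists_eq_exp_of_mem_closure hR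
        (norm_exp_I_mul_sum x) (exp_I_mul_sum_add x)
      refine ⟨(⟨θ, hθK⟩, fun k => (z k).im), fun ℓ => ?_, rfl⟩
      rw [← expComp_mul_eq_expComp_add (S ℓ) (a ℓ) _ (R θ) fun l hl => hθ l (hmem ℓ l hl),
        expComp_mul_eq_expComp_add (S ℓ) (a ℓ) _ x fun _ _ => rfl]
      simpa [x, Complex.re_add_im] using hz ℓ
    · rintro ⟨⟨θ, η⟩, hp, rfl⟩
      exact ⟨_, hp, by simp⟩
end

section
/- Let F = (f_1,…,f_m) be an exponential-sum mapping on ℂ^n which is Kazarnovskii regular. Then for every character χ of ℝ^n, the perturbed mapping F_χ is Kazarnovskii regular as well. -/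
open Complex
open scoped Classical

/-- `M(S, u)`: the set of points of the spectrum `S` on which the linear form
`⟨u, ·⟩` attains its maximum over `S` (for `u = 0` this is all of `S`). -/
noncomputable def maxFace {n : ℕ} (S : Finset (Fin n → ℝ)) (u : Fin n → ℝ) :
    Finset (Fin n → ℝ) :=
  S.filter fun l => ∀ μ ∈ S, ∑ k, u k * μ k ≤ ∑ k, u k * l k

/-- The Minkowski sum `M_1(u) + ⋯ + M_m(u)` of the maximizing faces of the
spectra in the direction `u`. -/
def minkFace {n m : ℕ} (S : Fin m → Finset (Fin n → ℝ)) (u : Fin n → ℝ) :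
    Set (Fin n → ℝ) :=
  {x | ∃ l : Fin m → Fin n → ℝ, (∀ ℓ, l ℓ ∈ maxFace (S ℓ) u) ∧ x = ∑ ℓ, l ℓ}

/-- Kazarnovskii's function `K[F^u](z) = ∑_ℓ exp(max_{λ ∈ M_ℓ(u)} ⟨Im z, λ⟩) · |f_ℓ^u(z)|`
associated with the `u`-truncation of the exponential-sum mapping. -/
noncomputable def kazFn {n m : ℕ} (S : Fin m → Finset (Fin n → ℝ))
    (a : Fin m → (Fin n → ℝ) → ℂ) (u : Fin n → ℝ) (z : Fin n → ℂ) : ℝ :=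
  ∑ ℓ, Real.exp (sSup ((fun l : Fin n → ℝ => ∑ k, (z k).im * l k) ''
      (maxFace (S ℓ) u : Set (Fin n → ℝ))))
    * ‖expComp (maxFace (S ℓ) u) (a ℓ) z‖

/-- Kazarnovskii regularity of an exponential-sum mapping: for every direction
`u` whose associated face of the Minkowski sum of the Newton polytopes has
dimension `< m`, the function `K[F^u]` is bounded below by a positive constant. -/
def KazRegular {n m : ℕ} (S : Fin m → Finset (Fin n → ℝ))
    (a : Fin m → (Fin n → ℝ) → ℂ) : Prop :=
  ∀ u : Fin n → ℝ,
    Module.finrank ℝ (affineSpan ℝ (minkFace S u)).direction < m →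
    ∃ ε > 0, ∀ z : Fin n → ℂ, ε ≤ kazFn S a u z

open Filter Topology

lemma tendsto_geom_average {w : ℂ} (hw : ‖w‖ = 1) :
    Tendsto (fun N : ℕ => (∑ j ∈ Finset.range N, w ^ j) / (N : ℂ)) atTop
      (𝓝 (if w = 1 then 1 else 0)) := by
  split_ifs with h
  · subst h
    refine tendsto_const_nhds.congr' ?_
    filter_upwards [eventually_gt_atTop 0] with N hN
    have : (N : ℂ) ≠ 0 := by exact_mod_cast hN.ne'
    simp [this]
  · refine squeeze_zero_norm (a := fun N : ℕ => (2 / ‖w - 1‖) / (N : ℝ)) (fun N => ?_)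
      (tendsto_const_div_atTop_nhds_zero_nat _)
    rw [geom_sum_eq h, norm_div, norm_div, Complex.norm_natCast]
    gcongr
    calc ‖w ^ N - 1‖ ≤ ‖w ^ N‖ + ‖(1 : ℂ)‖ := norm_sub_le _ _
      _ = 2 := by rw [norm_pow, hw]; norm_num

/-- The mean value of a bounded combination of unitary characters, i.e. the sum of the
coefficients of the trivial characters, is bounded by the same constant. -/
lemma norm_sum_trivial_addChar_le {G ι : Type*} [AddCommGroup G] (c : ι → AddChar G ℂ)
    (hc : ∀ i g, ‖c i g‖ = 1) (a : ι → ℂ) (M : ℝ) (s : Finset ι)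
    (h : ∀ x, ‖∑ i ∈ s, a i * c i x‖ ≤ M) :
    ‖∑ i ∈ s with c i = 1, a i‖ ≤ M := by
  induction s using Finset.strongInduction with
  | H s ih =>
  by_cases hs : ∀ i ∈ s, c i = 1
  · rw [Finset.filter_true_of_mem hs]
    simpa using h 0
  · push Not at hs
    obtain ⟨i₀, hi₀, hne⟩ := hs
    obtain ⟨g, hg⟩ : ∃ g, c i₀ g ≠ 1 := by
      by_contra! hcon
      exact hne (DFunLike.ext _ _ fun g => by simp [hcon g])
    have key := ih (s.filter fun i => c i g = 1)
      (Finset.filter_ssubset.2 ⟨i₀, hi₀, hg⟩) fun x => ?_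
    · rw [Finset.filter_filter] at key
      convert key using 4 with i
      constructor
      · intro hi
        exact ⟨by rw [hi]; simp, hi⟩
      · exact And.right
    · have hlim : Tendsto (fun N : ℕ => ∑ i ∈ s, a i * c i x *
          ((∑ j ∈ Finset.range N, c i g ^ j) / (N : ℂ))) atTop
          (𝓝 (∑ i ∈ s, a i * c i x * (if c i g = 1 then 1 else 0))) :=
        tendsto_finsetSum _ fun i _ => (tendsto_geom_average (hc i g)).const_mul _
      have hval : (∑ i ∈ s, a i * c i x * (if c i g = 1 then (1 : ℂ) else 0)) =
          ∑ i ∈ s with c i g = 1, a i * c i x := by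
        simp [Finset.sum_filter]
      rw [hval] at hlim
      refine le_of_tendsto hlim.norm ?_
      filter_upwards [eventually_gt_atTop 0] with N hN
      have hN' : (0 : ℝ) < N := by exact_mod_cast hN
      have hEq : (∑ i ∈ s, a i * c i x * ((∑ j ∈ Finset.range N, c i g ^ j) / (N : ℂ))) =
          (∑ j ∈ Finset.range N, ∑ i ∈ s, a i * c i (x + j • g)) / (N : ℂ) := by
        rw [Finset.sum_comm, Finset.sum_div]
        refine Finset.sum_congr rfl fun i _ => ?_
        rw [mul_div_assoc', Finset.mul_sum]
        congr 1
        refine Finset.sum_congr rfl fun j _ => ?_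
        rw [AddChar.map_add_eq_mul, AddChar.map_nsmul_eq_pow]
        ring
      rw [hEq, norm_div, Complex.norm_natCast, div_le_iff₀ hN']
      calc ‖∑ j ∈ Finset.range N, ∑ i ∈ s, a i * c i (x + j • g)‖
          ≤ ∑ j ∈ Finset.range N, M := norm_sum_le_of_le _ fun j _ => h _
        _ = M * N := by simp [mul_comm]

lemma addChar_map_sum {G R ι : Type*} [AddCommMonoid G] [CommMonoid R] (ψ : AddChar G R)
    (s : Finset ι) (f : ι → G) : ψ (∑ i ∈ s, f i) = ∏ i ∈ s, ψ (f i) := by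
  induction s using Finset.cons_induction with
  | empty => simp
  | cons i s hi ih => rw [Finset.sum_cons, Finset.prod_cons, AddChar.map_add_eq_mul, ih]

/-- The continuous character `t ↦ e^{i⟨t,μ⟩}` of `ℝⁿ`. -/
noncomputable def expChar {n : ℕ} (μ : Fin n → ℝ) : AddChar (Fin n → ℝ) ℂ where
  toFun t := Complex.exp (Complex.I * ((∑ k, t k * μ k : ℝ) : ℂ))
  map_zero_eq_one' := by simp
  map_add_eq_mul' s t := by
    rw [← Complex.exp_add, ← mul_add, ← Complex.ofReal_add, ← Finset.sum_add_distrib]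
    simp [add_mul]

lemma expChar_apply {n : ℕ} (μ t : Fin n → ℝ) :
    expChar μ t = Complex.exp (Complex.I * ((∑ k, t k * μ k : ℝ) : ℂ)) := rfl

lemma norm_expChar {n : ℕ} (μ t : Fin n → ℝ) : ‖expChar μ t‖ = 1 := by
  rw [expChar_apply, mul_comm, Complex.norm_exp_ofReal_mul_I]

lemma expChar_comm {n : ℕ} (μ t : Fin n → ℝ) : expChar μ t = expChar t μ := by
  simp only [expChar_apply, mul_comm]

lemma expChar_eq_one_iff {n : ℕ} {μ : Fin n → ℝ} : expChar μ = 1 ↔ μ = 0 := by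
  constructor
  · intro h
    by_contra hμ
    have hpos : 0 < ∑ k, μ k * μ k := by
      obtain ⟨k, hk⟩ := Function.ne_iff.1 hμ
      exact Finset.sum_pos' (fun k _ => mul_self_nonneg _)
        ⟨k, Finset.mem_univ _, mul_self_pos.2 hk⟩
    have h1 : expChar μ ((Real.pi / ∑ k, μ k * μ k) • μ) = 1 := by rw [h]; simp
    rw [expChar_apply] at h1
    have h2 : ∑ k, ((Real.pi / ∑ k, μ k * μ k) • μ) k * μ k = Real.pi := by
      simp only [Pi.smul_apply, smul_eq_mul, mul_assoc, ← Finset.mul_sum]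
      exact div_mul_cancel₀ _ hpos.ne'
    rw [h2, mul_comm, Complex.exp_pi_mul_I] at h1
    norm_num at h1
  · rintro rfl
    exact DFunLike.ext _ _ fun t => by simp [expChar_apply]

/-- A unitary character `ψ` of `ℝⁿ` cannot be separated from the continuous ones by
`∑_{λ ∈ Λ} ψ(λ) e^{i⟨t,λ⟩}`. -/
lemma card_le_of_norm_sum_addChar_le {n : ℕ} (ψ : AddChar (Fin n → ℝ) ℂ)
    (hψ : ∀ v, ‖ψ v‖ = 1) (Λ : Finset (Fin n → ℝ)) {M : ℝ}
    (hM : ∀ t, ‖∑ l ∈ Λ, ψ l * expChar l t‖ ≤ M) : (Λ.card : ℝ) ≤ M := by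
  have hM0 : 0 ≤ M := (norm_nonneg _).trans (hM 0)
  set σ : ((Fin n → ℝ) → ℕ) → (Fin n → ℝ) := fun κ => ∑ l ∈ Λ, κ l • l with hσ
  have hprod : ∀ κ t, ∏ l ∈ Λ, (ψ l * expChar l t) ^ κ l = ψ (σ κ) * expChar (σ κ) t := by
    intro κ t
    simp only [hσ, expChar_comm _ t, addChar_map_sum, AddChar.map_nsmul_eq_pow,
      mul_pow, Finset.prod_mul_distrib]
  have hmult : ∀ N, ∀ κ₀ ∈ Λ.piAntidiag N, (Nat.multinomial Λ κ₀ : ℝ) ≤ M ^ N := by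
    intro N κ₀ hκ₀
    have hb := norm_sum_trivial_addChar_le (fun κ => expChar (σ κ - σ κ₀))
      (fun κ t => norm_expChar _ _)
      (fun κ => (Nat.multinomial Λ κ : ℂ) * ψ (σ κ - σ κ₀)) (M ^ N) (Λ.piAntidiag N) ?_
    · refine le_trans ?_ hb
      have hcoef : ∑ κ ∈ Λ.piAntidiag N with expChar (σ κ - σ κ₀) = 1,
          (Nat.multinomial Λ κ : ℂ) * ψ (σ κ - σ κ₀) =
          ((∑ κ ∈ Λ.piAntidiag N with expChar (σ κ - σ κ₀) = 1,
            Nat.multinomial Λ κ : ℕ) : ℂ) := by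
        push_cast
        refine Finset.sum_congr rfl fun κ hκ => ?_
        rw [expChar_eq_one_iff.1 (Finset.mem_filter.1 hκ).2]
        simp
      rw [hcoef, Complex.norm_natCast]
      refine Nat.cast_le.2 (Finset.single_le_sum (f := fun κ => Nat.multinomial Λ κ)
        (fun _ _ => Nat.zero_le _) (Finset.mem_filter.2 ⟨hκ₀, ?_⟩))
      rw [sub_self, expChar_eq_one_iff]
    · intro t
      have hW : ‖ψ (σ κ₀) * expChar (σ κ₀) t‖ = 1 := by
        rw [norm_mul, hψ, norm_expChar, one_mul]
      have hpow : (∑ κ ∈ Λ.piAntidiag N, (Nat.multinomial Λ κ : ℂ) * ψ (σ κ - σ κ₀) *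
            expChar (σ κ - σ κ₀) t) * (ψ (σ κ₀) * expChar (σ κ₀) t) =
          (∑ l ∈ Λ, ψ l * expChar l t) ^ N := by
        rw [Finset.sum_pow_eq_sum_piAntidiag, Finset.sum_mul]
        refine Finset.sum_congr rfl fun κ _ => ?_
        rw [hprod]
        have e1 : ψ (σ κ) = ψ (σ κ - σ κ₀) * ψ (σ κ₀) := by
          rw [← AddChar.map_add_eq_mul, sub_add_cancel]
        have e2 : expChar (σ κ) t = expChar (σ κ - σ κ₀) t * expChar (σ κ₀) t := by
          simp only [expChar_comm _ t]
          rw [← AddChar.map_add_eq_mul, sub_add_cancel]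
        rw [e1, e2]
        ring
      rw [← mul_one ‖_‖, ← hW, ← norm_mul, hpow, norm_pow]
      exact pow_le_pow_left₀ (norm_nonneg _) (hM t) N
  have hcard : ∀ N, (Λ.piAntidiag N).card ≤ (N + 1) ^ Λ.card := by
    intro N
    calc (Λ.piAntidiag N).card
        ≤ (Λ.pi fun _ => Finset.range (N + 1)).card := by
          refine Finset.card_le_card_of_injOn (fun κ l _ => κ l) ?_ ?_
          · intro κ hκ
            simp only [Finset.mem_coe, Finset.mem_piAntidiag, Finset.mem_pi,
              Finset.mem_range] at hκ ⊢
            intro l hl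
            have := Finset.single_le_sum (f := κ) (fun _ _ => Nat.zero_le _) hl
            rw [hκ.1] at this
            exact Nat.lt_succ_of_le this
          · intro κ hκ κ' hκ' heq
            simp only [Finset.mem_coe, Finset.mem_piAntidiag] at hκ hκ'
            funext l
            by_cases hl : l ∈ Λ
            · exact congrFun (congrFun heq l) hl
            · rw [not_imp_comm.1 (hκ.2 l) hl, not_imp_comm.1 (hκ'.2 l) hl]
      _ = (N + 1) ^ Λ.card := by simp
  have hgrowth : ∀ N : ℕ, (Λ.card : ℝ) ^ N ≤ ((N + 1 : ℕ) : ℝ) ^ Λ.card * M ^ N := by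
    intro N
    have hsum := Finset.sum_pow_eq_sum_piAntidiag Λ (fun _ => (1 : ℝ)) N
    simp only [Finset.sum_const, nsmul_eq_mul, mul_one, one_pow, Finset.prod_const_one] at hsum
    rw [hsum]
    calc ∑ κ ∈ Λ.piAntidiag N, (Nat.multinomial Λ κ : ℝ)
        ≤ ∑ κ ∈ Λ.piAntidiag N, M ^ N := Finset.sum_le_sum (hmult N)
      _ = ((Λ.piAntidiag N).card : ℝ) * M ^ N := by simp
      _ ≤ _ := by
        gcongr
        exact_mod_cast hcard N
  by_contra! hlt
  have hΛ : (0 : ℝ) < Λ.card := hM0.trans_lt hlt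
  rcases hM0.eq_or_lt with rfl | hMpos
  · have := hgrowth 1
    simp only [pow_one, mul_zero] at this
    linarith
  set r : ℝ := Λ.card / M with hr
  have hr1 : 1 < r := (one_lt_div hMpos).2 hlt
  have hlim := (tendsto_pow_const_div_const_pow_of_one_lt Λ.card hr1).comp
    (tendsto_add_atTop_nat 1)
  have hge : ∀ N : ℕ, r⁻¹ ≤ ((fun n : ℕ => (n : ℝ) ^ Λ.card / r ^ n) ∘ fun a => a + 1) N := by
    intro N
    have hrN : r ^ N ≤ ((N + 1 : ℕ) : ℝ) ^ Λ.card := by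
      rw [hr, div_pow, div_le_iff₀ (by positivity)]
      exact hgrowth N
    have hr0 : 0 < r := by linarith
    simp only [Function.comp_apply]
    rw [le_div_iff₀ (by positivity), pow_succ, mul_comm, mul_assoc, mul_inv_cancel₀ hr0.ne',
      mul_one]
    exact hrN
  have := ge_of_tendsto' hlim hge
  have : 0 < r⁻¹ := by positivity
  linarith

/-- **Kronecker approximation**: on a finite set, every unitary character of `ℝⁿ` is
approximated by continuous ones. -/
lemma exists_norm_expChar_sub_lt {n : ℕ} (χ : AddChar (Fin n → ℝ) ℂ)
    (hχ : ∀ v, ‖χ v‖ = 1) (Λ : Finset (Fin n → ℝ)) {δ : ℝ} (hδ : 0 < δ) :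
    ∃ t, ∀ l ∈ Λ, ‖expChar l t - χ l‖ < δ := by
  have hinv : ∀ v, χ (-v) * χ v = 1 := fun v => by
    rw [← AddChar.map_add_eq_mul, neg_add_cancel, AddChar.map_zero_eq_one]
  let ψ : AddChar (Fin n → ℝ) ℂ :=
    { toFun := fun v => χ (-v)
      map_zero_eq_one' := by simp
      map_add_eq_mul' := fun v w => by rw [neg_add, AddChar.map_add_eq_mul] }
  have hψ : ∀ v, ψ v = χ (-v) := fun _ => rfl
  set Λ' := insert 0 Λ
  obtain ⟨t, ht⟩ : ∃ t, (Λ'.card : ℝ) - δ ^ 2 / 4 < ‖∑ l ∈ Λ', ψ l * expChar l t‖ := by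
    by_contra! hcon
    have := card_le_of_norm_sum_addChar_le ψ (fun v => hχ _) Λ' hcon
    have : 0 < δ ^ 2 := by positivity
    linarith
  refine ⟨t, fun l hl => ?_⟩
  have hW : ∀ μ, ‖ψ μ * expChar μ t‖ = 1 := fun μ => by
    rw [norm_mul, norm_expChar, hψ, hχ, one_mul]
  have hred : ‖expChar l t - χ l‖ = ‖1 - ψ l * expChar l t‖ := by
    have : expChar l t - χ l = -(χ l) * (1 - ψ l * expChar l t) := by
      rw [hψ]
      linear_combination (-expChar l t) * hinv l
    rw [this, norm_mul, norm_neg, hχ, one_mul]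
  rw [hred]
  by_cases hl0 : l = 0
  · subst hl0
    have : expChar (0 : Fin n → ℝ) = 1 := expChar_eq_one_iff.2 rfl
    simpa [this] using hδ
  · have hmem : l ∈ Λ'.erase 0 := Finset.mem_erase.2 ⟨hl0, Finset.mem_insert_of_mem hl⟩
    have h0 : (0 : Fin n → ℝ) ∈ Λ' := Finset.mem_insert_self _ _
    have hψ0 : ψ 0 * expChar 0 t = 1 := by
      rw [expChar_eq_one_iff.2 rfl]; simp
    have hcard : (Λ'.card : ℝ) = ((Λ'.erase 0).erase l).card + 2 := by
      rw [← Finset.card_erase_add_one h0, ← Finset.card_erase_add_one hmem]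
      push_cast
      ring
    rw [← Finset.add_sum_erase _ _ h0, ← Finset.add_sum_erase _ _ hmem, ← add_assoc, hψ0,
      hcard] at ht
    have hrest : ‖∑ x ∈ (Λ'.erase 0).erase l, ψ x * expChar x t‖ ≤
        (((Λ'.erase 0).erase l).card : ℝ) :=
      (norm_sum_le_of_le _ fun x _ => (hW x).le).trans (by simp)
    have hadd := norm_add_le (1 + ψ l * expChar l t)
      (∑ x ∈ (Λ'.erase 0).erase l, ψ x * expChar x t)
    have hpar := parallelogram_law_with_norm ℝ (1 : ℂ) (ψ l * expChar l t)
    rw [hW l, norm_one] at hpar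
    have hnn := norm_nonneg (1 + ψ l * expChar l t)
    have h2 : 2 - δ ^ 2 / 4 < ‖1 + ψ l * expChar l t‖ := by linarith
    refine lt_of_pow_lt_pow_left₀ 2 hδ.le ?_
    nlinarith [sq_nonneg (‖1 + ψ l * expChar l t‖ - 2)]

lemma expComp_add_ofReal {n : ℕ} (S : Finset (Fin n → ℝ)) (a : (Fin n → ℝ) → ℂ)
    (z : Fin n → ℂ) (t : Fin n → ℝ) :
    expComp S a (fun k => z k + (t k : ℂ)) = expComp S (fun l => a l * expChar l t) z := by
  refine Finset.sum_congr rfl fun l _ => ?_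
  have : Complex.I * ∑ k, (z k + (t k : ℂ)) * (l k : ℂ) =
      Complex.I * ((∑ k, t k * l k : ℝ) : ℂ) + Complex.I * ∑ k, z k * (l k : ℂ) := by
    push_cast
    rw [← mul_add, ← Finset.sum_add_distrib]
    congr 1
    exact Finset.sum_congr rfl fun k _ => by ring
  simp only [this, Complex.exp_add, expChar_apply]
  ring

lemma kazFn_add_ofReal {n m : ℕ} (S : Fin m → Finset (Fin n → ℝ))
    (a : Fin m → (Fin n → ℝ) → ℂ) (u : Fin n → ℝ) (z : Fin n → ℂ) (t : Fin n → ℝ) :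
    kazFn S a u (fun k => z k + (t k : ℂ)) =
      kazFn S (fun ℓ l => a ℓ l * expChar l t) u z := by
  simp [kazFn, expComp_add_ofReal]

/-- Lemma 6.2: if an exponential-sum mapping is Kazarnovskii regular, then so is
its perturbation by any character of `ℝⁿ`. -/
theorem kazRegular_of_perturbation (n m : ℕ)
    (S : Fin m → Finset (Fin n → ℝ)) (hS : ∀ ℓ, (S ℓ).Nonempty)
    (a : Fin m → (Fin n → ℝ) → ℂ) (ha : ∀ ℓ, ∀ l ∈ S ℓ, a ℓ l ≠ 0)
    (hreg : KazRegular S a)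
    (χ : (Fin n → ℝ) → ℂ)
    (hχ1 : ∀ v, ‖χ v‖ = 1)
    (hχadd : ∀ v w, χ (v + w) = χ v * χ w) :
    KazRegular S (fun ℓ l => a ℓ l * χ l) := by
  intro u hu
  obtain ⟨ε, hε, hbound⟩ := hreg u hu
  refine ⟨ε, hε, fun z => ?_⟩
  have hχ0 : χ 0 = 1 := by
    have h0 : χ 0 ≠ 0 := fun h => by simpa [h] using hχ1 0
    have := hχadd 0 0
    rw [add_zero] at this
    exact mul_left_cancel₀ h0 (by rw [← this, mul_one])
  let χ' : AddChar (Fin n → ℝ) ℂ := ⟨χ, hχ0, hχadd⟩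
  choose t ht using fun j : ℕ => exists_norm_expChar_sub_lt χ' hχ1
    (Finset.univ.biUnion S) (Nat.one_div_pos_of_nat (α := ℝ) (n := j))
  have hlim : ∀ ℓ, ∀ l ∈ S ℓ, Tendsto (fun j => expChar l (t j)) atTop (𝓝 (χ l)) := by
    intro ℓ l hl
    rw [tendsto_iff_norm_sub_tendsto_zero]
    refine squeeze_zero (fun _ => norm_nonneg _) (fun j => (ht j l ?_).le)
      tendsto_one_div_add_atTop_nhds_zero_nat
    exact Finset.mem_biUnion.2 ⟨ℓ, Finset.mem_univ _, hl⟩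
  have hK : Tendsto (fun j => kazFn S (fun ℓ l => a ℓ l * expChar l (t j)) u z) atTop
      (𝓝 (kazFn S (fun ℓ l => a ℓ l * χ l) u z)) := by
    refine tendsto_finsetSum _ fun ℓ _ => Tendsto.const_mul _ (Tendsto.norm ?_)
    refine tendsto_finsetSum _ fun l hl => Tendsto.mul_const _ (Tendsto.const_mul _ ?_)
    exact hlim ℓ l (Finset.mem_filter.1 hl).1
  refine ge_of_tendsto' hK fun j => ?_
  rw [← kazFn_add_ofReal]
  exact hbound _
end
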